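/- arXiv:1703.08159 — 2 statements merged into one kernel-verified Lean document; each statement's English description precedes it below -/
import Mathlib

section
/- Let d, Δ₁, Δ₂ be real, h=d/2, Δ₋=(Δ₁−Δ₂)/2, and let Δ be complex with Δ+1−h not a nonpositive integer. Then the bulk conformal block G_Δ^bulk is twice differentiable on (0,1) and satisfies the Casimir equation (D_bulk G_Δ^bulk)(ρ) = Δ(Δ−d)·G_Δ^bulk(ρ) for all 0<ρ<1. -/
open scoped Real
open Complex MeasureTheory Set ComplexConjugate

noncomputable section

/-- Pochhammer symbol `(a)ₙ = a (a+1) ⋯ (a+n−1)`. -/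
def poch (a : ℂ) (n : ℕ) : ℂ := (ascPochhammer ℂ n).eval a

/-- Gauss hypergeometric series `₂F₁(a,b;c;z)`. -/
def hyp2F1 (a b c z : ℂ) : ℂ :=
  ∑' n : ℕ, poch a n * poch b n / (poch c n * (n.factorial : ℂ)) * z ^ n

/-- Jacobi function `ϑ_α^{(p,q)}(x)` on `0 < x < 1`. -/
def thetaJ (p q α : ℂ) (x : ℝ) : ℂ :=
  (x : ℂ) ^ ((1 + p + q) / 2 + α) *
    hyp2F1 ((1 + p + q) / 2 + α) ((1 + p - q) / 2 + α) (1 + p) (1 - (x : ℂ))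

/-- The bulk Casimir operator `D_bulk` (with `h = d/2`, `Δm = Δ₋`). -/
def Dbulk (h Δm : ℝ) (f : ℝ → ℂ) (ρ : ℝ) : ℂ :=
  4 * (ρ : ℂ) ^ ((h + 1 : ℝ) : ℂ) *
      deriv (fun y : ℝ => (y : ℂ) ^ ((1 - h : ℝ) : ℂ) * (1 - (y : ℂ)) * deriv f y) ρ
    - 4 * (Δm : ℂ) ^ 2 * ((ρ : ℂ) / (1 - (ρ : ℂ))) * f ρ

/-- The bulk conformal block `G_Δ^bulk`. -/
def Gbulk (h Δm : ℝ) (Δ : ℂ) (ρ : ℝ) : ℂ :=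
  (ρ : ℂ) ^ (Δ / 2) * (1 - (ρ : ℂ)) ^ (Δm : ℂ) *
    hyp2F1 (Δ / 2 + (Δm : ℂ)) (Δ / 2 + 1 - (h : ℂ) + (Δm : ℂ)) (Δ + 1 - (h : ℂ)) (ρ : ℂ)

open Filter Topology in
/-- A power series converging on the open unit disc may be differentiated termwise there. -/
lemma hasDerivAt_tsum_pow_of_summable {u : ℕ → ℂ}
    (hu : ∀ z : ℂ, ‖z‖ < 1 → Summable fun n => u n * z ^ n) {z : ℂ} (hz : ‖z‖ < 1) :
    ∃ s : ℂ, HasSum (fun n : ℕ => ((n : ℂ) + 1) * u (n + 1) * z ^ n) s ∧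
      HasDerivAt (fun w : ℂ => ∑' n, u n * w ^ n) s z := by
  let p := FormalMultilinearSeries.ofScalars ℂ u
  have hrad : 1 ≤ p.radius := by
    refine ENNReal.le_of_forall_nnreal_lt fun r hr => ?_
    have hr' : ‖((r : ℝ) : ℂ)‖ < 1 := by
      simpa using (by exact_mod_cast hr : (r : ℝ) < 1)
    refine p.le_radius_of_summable ((hu _ hr').norm.congr fun n => ?_)
    simp [p]
  have hsum : p.sum = fun w : ℂ => ∑' n, u n * w ^ n := by
    funext w
    simp [FormalMultilinearSeries.sum, p, mul_comm]
  have hp : HasFPowerSeriesOnBall (fun w : ℂ => ∑' n, u n * w ^ n) p 0 1 := by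
    rw [← hsum]
    exact (p.hasFPowerSeriesOnBall (zero_lt_one.trans_le hrad)).mono zero_lt_one hrad
  have hmem : z ∈ Metric.eball (0 : ℂ) 1 := by
    simpa [Metric.mem_eball, edist_zero_right, ← ofReal_norm] using hz
  refine ⟨_, ?_, (hp.differentiableOn.differentiableAt
    (Metric.isOpen_eball.mem_nhds hmem)).hasDerivAt⟩
  have h := (hp.fderiv.hasSum hmem).mapL (ContinuousLinearMap.apply ℂ ℂ (1 : ℂ))
  simp only [zero_add, ContinuousLinearMap.apply_apply, fderiv_apply_one_eq_deriv] at h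
  refine h.congr_fun fun n => ?_
  have hcoeff := p.derivSeries_coeff_one n
  rw [FormalMultilinearSeries.apply_eq_pow_smul_coeff, _root_.smul_apply, hcoeff]
  simp only [p, FormalMultilinearSeries.coeff_ofScalars, nsmul_eq_mul, smul_eq_mul]
  push_cast
  ring

/-- Multiplying a termwise derivative by the variable gives the series of `z · d/dz`. -/
lemma HasSum.nat_mul_pow {v : ℕ → ℂ} {s z : ℂ}
    (h : HasSum (fun n : ℕ => ((n : ℂ) + 1) * v (n + 1) * z ^ n) s) :
    HasSum (fun n : ℕ => (n : ℂ) * v n * z ^ n) (z * s) := by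
  rw [← hasSum_nat_add_iff' 1]
  simpa [pow_succ, mul_comm, mul_left_comm, mul_assoc] using h.mul_left z

/-- The coefficients of the hypergeometric series. -/
def hypCoeff (a b c : ℂ) (n : ℕ) : ℂ := poch a n * poch b n / (poch c n * (n.factorial : ℂ))

lemma add_natCast_ne_zero {c : ℂ} (hc : ∀ n : ℕ, c ≠ -(n : ℂ)) (n : ℕ) : c + n ≠ 0 :=
  fun h => hc n (eq_neg_of_add_eq_zero_left h)

lemma hypCoeff_succ {a b c : ℂ} (hc : ∀ n : ℕ, c ≠ -(n : ℂ)) (n : ℕ) :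
    hypCoeff a b c (n + 1) =
      (a + n) / (c + n) * ((b + n) / (1 + n)) * hypCoeff a b c n := by
  have hcn := add_natCast_ne_zero hc n
  have hn : (1 + n : ℂ) ≠ 0 := by
    rw [add_comm]
    exact n.cast_add_one_ne_zero
  simp only [hypCoeff, poch, ascPochhammer_succ_eval, Nat.factorial_succ]
  push_cast
  field

open Filter Topology in
lemma summable_hypCoeff {a b c : ℂ} (hc : ∀ n : ℕ, c ≠ -(n : ℂ)) {z : ℂ} (hz : ‖z‖ < 1) :
    Summable fun n => hypCoeff a b c n * z ^ n := by
  have hlim (x y : ℂ) : Tendsto (fun n : ℕ => (x + n) / (y + n)) atTop (𝓝 1) := by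
    convert! tendsto_add_mul_div_add_mul_atTop_nhds x y (1 : ℂ) one_ne_zero <;> simp
  have hq := (((hlim a c).mul (hlim b 1)).mul_const z).norm
  rw [one_mul, one_mul] at hq
  obtain ⟨r, hzr, hr⟩ := exists_between hz
  refine summable_of_ratio_norm_eventually_le hr ?_
  filter_upwards [hq.eventually_le_const hzr] with n hn
  rw [hypCoeff_succ hc, pow_succ]
  calc _ = ‖(a + n) / (c + n) * ((b + n) / (1 + n)) * z‖ * ‖hypCoeff a b c n * z ^ n‖ := by
        rw [← norm_mul]
        ring_nf
    _ ≤ _ := by gcongr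

/-- The hypergeometric function satisfies Gauss's differential equation on the unit disc. -/
lemma exists_hasDerivAt_hyp2F1 {a b c : ℂ} (hc : ∀ n : ℕ, c ≠ -(n : ℂ)) :
    ∃ F₁ F₂ : ℂ → ℂ, ∀ z : ℂ, ‖z‖ < 1 →
      HasDerivAt (hyp2F1 a b c) (F₁ z) z ∧ HasDerivAt F₁ (F₂ z) z ∧
      z * (1 - z) * F₂ z + (c - (a + b + 1) * z) * F₁ z - a * b * hyp2F1 a b c z = 0 := by
  let u := hypCoeff a b c
  let v : ℕ → ℂ := fun n => (n + 1) * u (n + 1)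
  have hu : ∀ z : ℂ, ‖z‖ < 1 → Summable fun n => u n * z ^ n := fun z => summable_hypCoeff hc
  have hv : ∀ z : ℂ, ‖z‖ < 1 → Summable fun n => v n * z ^ n := fun z hz =>
    (hasDerivAt_tsum_pow_of_summable hu hz).choose_spec.1.summable
  choose! F₁ hF₁ using fun (z : ℂ) (hz : ‖z‖ < 1) => hasDerivAt_tsum_pow_of_summable hu hz
  choose! F₂ hF₂ using fun (z : ℂ) (hz : ‖z‖ < 1) => hasDerivAt_tsum_pow_of_summable hv hz
  refine ⟨F₁, F₂, fun z hz => ⟨(hF₁ z hz).2, (hF₂ z hz).2.congr_of_eventuallyEq ?_, ?_⟩⟩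
  · filter_upwards [(isOpen_lt continuous_norm continuous_const).mem_nhds hz] with w hw
    exact (hF₁ w hw).1.tsum_eq.symm
  have h₀ : HasSum (fun n => u n * z ^ n) (hyp2F1 a b c z) := (hu z hz).hasSum
  have h₁ := (hF₁ z hz).1
  have hz₁ := h₁.nat_mul_pow
  have hz₂ := (hF₂ z hz).1.nat_mul_pow
  have hzz₂ : HasSum (fun n : ℕ => (n : ℂ) * ((n - 1) * u n) * z ^ n) (z * (z * F₂ z)) := by
    refine HasSum.nat_mul_pow (v := fun n => ((n : ℂ) - 1) * u n) (hz₂.congr_fun fun n => ?_)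
    simp only [v]
    push_cast
    ring
  have key := (((hz₂.sub hzz₂).add (h₁.mul_left c)).sub (hz₁.mul_left (a + b + 1))).sub
    (h₀.mul_left (a * b))
  have hzero := key.unique (by
    convert! hasSum_zero using 1
    funext n
    have hcn := add_natCast_ne_zero hc n
    have hn : (1 + n : ℂ) ≠ 0 := by
      rw [add_comm]
      exact n.cast_add_one_ne_zero
    simp only [v, u, hypCoeff_succ hc n]
    field_simp
    ring)
  linear_combination hzero

lemma hasDerivAt_cpow_const_div {z : ℂ} (hz : z ∈ slitPlane) (r : ℂ) :
    HasDerivAt (fun w : ℂ => w ^ r) (z ^ r * (r / z)) z := by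
  convert! (hasDerivAt_id z).cpow_const (c := r) hz using 1
  have := slitPlane_ne_zero hz
  simp only [id, cpow_sub _ _ this, cpow_one]
  ring

lemma hasDerivAt_cpow_mul_one_sub_cpow {z : ℂ} (hz : z ∈ slitPlane) (hz' : 1 - z ∈ slitPlane)
    (r s : ℂ) :
    HasDerivAt (fun w : ℂ => w ^ r * (1 - w) ^ s)
      (z ^ r * (1 - z) ^ s * (r / z - s / (1 - z))) z := by
  convert! (hasDerivAt_cpow_const_div hz r).mul
    ((hasDerivAt_cpow_const_div hz' s).comp z ((hasDerivAt_id z).const_sub 1)) using 1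
  simp
  ring

theorem stmt6 (d Δ₁ Δ₂ h Δm : ℝ) (hh : h = d / 2) (hm : Δm = (Δ₁ - Δ₂) / 2)
    (Δ : ℂ) (hΔ : ∀ n : ℕ, Δ + 1 - (h : ℂ) ≠ -(n : ℂ)) :
    ∀ ρ ∈ Ioo (0 : ℝ) 1,
      DifferentiableAt ℝ (Gbulk h Δm Δ) ρ ∧
      DifferentiableAt ℝ (deriv (Gbulk h Δm Δ)) ρ ∧
      Dbulk h Δm (Gbulk h Δm Δ) ρ = Δ * (Δ - (d : ℂ)) * Gbulk h Δm Δ ρ := by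
  intro ρ hρ
  obtain ⟨F₁, F₂, hF⟩ := exists_hasDerivAt_hyp2F1 (a := Δ / 2 + Δm)
    (b := Δ / 2 + 1 - h + Δm) (c := Δ + 1 - h) hΔ
  set F := hyp2F1 (Δ / 2 + Δm) (Δ / 2 + 1 - h + Δm) (Δ + 1 - h) with hFdef
  let L : ℂ → ℂ := fun z => (Δ / 2) / z - Δm / (1 - z)
  let g₁ : ℂ → ℂ := fun z => z ^ (Δ / 2) * (1 - z) ^ (Δm : ℂ) * (L z * F z + F₁ z)
  have hmem : ∀ x ∈ Ioo (0 : ℝ) 1,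
      (x : ℂ) ∈ slitPlane ∧ 1 - (x : ℂ) ∈ slitPlane ∧ ‖(x : ℂ)‖ < 1 := fun x hx =>
    ⟨Or.inl (by simpa using hx.1), Or.inl (by simpa using hx.2), by
      simpa [abs_of_pos hx.1] using hx.2⟩
  have hG : ∀ x ∈ Ioo (0 : ℝ) 1, HasDerivAt (Gbulk h Δm Δ) (g₁ x) x := fun x hx => by
    obtain ⟨h₀, h₁, h₂⟩ := hmem x hx
    have := ((hasDerivAt_cpow_mul_one_sub_cpow h₀ h₁ (Δ / 2) Δm).mul (hF x h₂).1).comp_ofReal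
    convert! this using 1
    simp only [g₁, L]
    ring
  have hderiv : deriv (Gbulk h Δm Δ) =ᶠ[nhds ρ] fun x : ℝ => g₁ x := by
    filter_upwards [isOpen_Ioo.mem_nhds hρ] with x hx using (hG x hx).deriv
  obtain ⟨h₀, h₁, h₂⟩ := hmem ρ hρ
  obtain ⟨hF₁, hF₂, hode⟩ := hF ρ h₂
  have hne := slitPlane_ne_zero h₀
  have hne' := slitPlane_ne_zero h₁
  have hL : HasDerivAt L (-(Δ / 2) / (ρ : ℂ) ^ 2 - Δm / (1 - (ρ : ℂ)) ^ 2) ρ := by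
    convert! ((hasDerivAt_const (ρ : ℂ) (Δ / 2)).div (hasDerivAt_id _) hne).sub
      ((hasDerivAt_const (ρ : ℂ) (Δm : ℂ)).div ((hasDerivAt_id _).const_sub 1) hne') using 1
    simp
  have hg₁ := (hasDerivAt_cpow_mul_one_sub_cpow h₀ h₁ (Δ / 2) Δm).mul ((hL.mul hF₁).add hF₂)
  refine ⟨(hG ρ hρ).differentiableAt,
    (hg₁.comp_ofReal.congr_of_eventuallyEq hderiv).differentiableAt, ?_⟩
  have hw := (((hasDerivAt_cpow_const_div h₀ ((1 - h : ℝ) : ℂ)).mul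
    ((hasDerivAt_id (ρ : ℂ)).const_sub 1)).mul hg₁).comp_ofReal
  have hD := (hw.congr_of_eventuallyEq
    (f₁ := fun y : ℝ => (y : ℂ) ^ ((1 - h : ℝ) : ℂ) * (1 - (y : ℂ)) * deriv (Gbulk h Δm Δ) y)
    (by filter_upwards [hderiv] with x hx; simp [hx, g₁])).deriv
  have hpow : (ρ : ℂ) ^ ((h + 1 : ℝ) : ℂ) * (ρ : ℂ) ^ ((1 - h : ℝ) : ℂ) = (ρ : ℂ) ^ 2 := by
    rw [← cpow_add _ _ hne, ← cpow_natCast]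
    congr 1
    push_cast
    ring
  have hd : (d : ℂ) = 2 * h := by
    rw [hh]
    push_cast
    ring
  simp only [Dbulk, hD, hd]
  simp only [Gbulk, ← hFdef, id, Pi.mul_apply, Pi.add_apply, L]
  generalize (ρ : ℂ) ^ ((h + 1 : ℝ) : ℂ) = A at *
  generalize (ρ : ℂ) ^ ((1 - h : ℝ) : ℂ) = B at *
  generalize (ρ : ℂ) ^ (Δ / 2) * (1 - (ρ : ℂ)) ^ (Δm : ℂ) = P at *
  push_cast
  linear_combination (norm := skip)
    4 * (((1 - h) / ρ * (1 - ρ) - 1) * (P * ((Δ / 2 / ρ - Δm / (1 - ρ)) * F ρ + F₁ ρ)) +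
      (1 - ρ) * (P * (Δ / 2 / ρ - Δm / (1 - ρ)) * ((Δ / 2 / ρ - Δm / (1 - ρ)) * F ρ + F₁ ρ) +
        P * ((-(Δ / 2) / ρ ^ 2 - Δm / (1 - ρ) ^ 2) * F ρ +
          (Δ / 2 / ρ - Δm / (1 - ρ)) * F₁ ρ + F₂ ρ))) * hpow + 4 * ρ * P * hode
  field_simp
  ring
end
end

section
/- Let d, Δ₁, Δ₂ be real, h=d/2, Δ₋=(Δ₁−Δ₂)/2, and let Δ be complex with Δ+1−h not a nonpositive integer. Then the crosscap conformal block G_Δ^proj is twice differentiable on (0,1) and satisfies the Casimir equation (D_proj G_Δ^proj)(η) = Δ(Δ−d)·G_Δ^proj(η) for all 0<η<1. -/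
open scoped Real
open Complex MeasureTheory Set ComplexConjugate

noncomputable section

/-- The crosscap Casimir operator `D_proj` (with `h = d/2`, `Δm = Δ₋`). -/
def Dproj (h Δm : ℝ) (f : ℝ → ℂ) (η : ℝ) : ℂ :=
  4 * (η : ℂ) ^ ((h + 1 : ℝ) : ℂ) * (1 - (η : ℂ)) ^ ((1 - h : ℝ) : ℂ) *
      deriv (fun y : ℝ =>
        (1 - (y : ℂ)) ^ ((h : ℝ) : ℂ) * (y : ℂ) ^ ((1 - h : ℝ) : ℂ) * deriv f y) η
    + 4 * (Δm : ℂ) ^ 2 * (η : ℂ) * f η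

/-- The crosscap conformal block `G_Δ^proj`. -/
def Gproj (h Δm : ℝ) (Δ : ℂ) (η : ℝ) : ℂ :=
  (η : ℂ) ^ (Δ / 2) * hyp2F1 (Δ / 2 + (Δm : ℂ)) (Δ / 2 - (Δm : ℂ)) (Δ + 1 - (h : ℂ)) (η : ℂ)

/-- Coefficients of the Gauss hypergeometric series. -/
def hyp2F1Coeff (a b c : ℂ) (n : ℕ) : ℂ :=
  poch a n * poch b n / (poch c n * (n.factorial : ℂ))

lemma poch_succ (a : ℂ) (n : ℕ) : poch a (n + 1) = poch a n * (a + n) :=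
  ascPochhammer_succ_eval n a

lemma poch_ne_zero {c : ℂ} (hc : ∀ n : ℕ, c ≠ -(n : ℂ)) (n : ℕ) : poch c n ≠ 0 := by
  induction n with
  | zero => simp [poch]
  | succ n ih =>
    rw [poch_succ]
    exact mul_ne_zero ih fun h => hc n (eq_neg_of_add_eq_zero_left h)

lemma hyp2F1Coeff_succ (a b : ℂ) {c : ℂ} (hc : ∀ n : ℕ, c ≠ -(n : ℂ)) (n : ℕ) :
    ((n : ℂ) + 1) * (c + n) * hyp2F1Coeff a b c (n + 1) =
      (a + n) * (b + n) * hyp2F1Coeff a b c n := by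
  have hn : (n : ℂ) + 1 ≠ 0 := by exact_mod_cast n.succ_ne_zero
  have hf : (n.factorial : ℂ) ≠ 0 := by exact_mod_cast n.factorial_ne_zero
  have hp := poch_ne_zero hc n
  have hcn : c + n ≠ 0 := fun h => hc n (eq_neg_of_add_eq_zero_left h)
  simp only [hyp2F1Coeff, poch_succ, Nat.factorial_succ, Nat.cast_mul, Nat.cast_add, Nat.cast_one]
  field_simp

lemma one_le_ordinaryHypergeometricSeries_radius (a b c : ℂ) :
    1 ≤ (ordinaryHypergeometricSeries ℂ a b c).radius := by
  by_cases h : ∀ k : ℕ, (k : ℂ) ≠ -a ∧ (k : ℂ) ≠ -b ∧ (k : ℂ) ≠ -c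
  · exact (ordinaryHypergeometricSeries_radius_eq_one ℂ a b c h).ge
  · simp only [not_forall, not_and_or, not_not] at h
    obtain ⟨k, h | h | h⟩ := h
    · obtain rfl : a = -(k : ℂ) := by rw [h, neg_neg]
      simp [ordinaryHypergeometric_radius_top_of_neg_nat₁]
    · obtain rfl : b = -(k : ℂ) := by rw [h, neg_neg]
      simp [ordinaryHypergeometric_radius_top_of_neg_nat₂]
    · obtain rfl : c = -(k : ℂ) := by rw [h, neg_neg]
      simp [ordinaryHypergeometric_radius_top_of_neg_nat₃]

lemma summable_norm_hyp2F1Coeff (a b c : ℂ) {r : ℝ} (hr : r ∈ Ioo (0 : ℝ) 1) :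
    Summable fun n => ‖hyp2F1Coeff a b c n‖ * r ^ n := by
  lift r to NNReal using hr.1.le
  have hr1 : (r : ENNReal) < (ordinaryHypergeometricSeries ℂ a b c).radius :=
    lt_of_lt_of_le (by exact_mod_cast hr.2) (one_le_ordinaryHypergeometricSeries_radius a b c)
  convert (ordinaryHypergeometricSeries ℂ a b c).summable_norm_mul_pow hr1 using 3 with n
  rw [ordinaryHypergeometricSeries, FormalMultilinearSeries.ofScalars_norm]
  congr 1
  simp only [hyp2F1Coeff, poch, div_eq_mul_inv, mul_inv]
  ring

lemma summable_norm_succ_mul {u : ℕ → ℂ}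
    (hu : ∀ r ∈ Ioo (0 : ℝ) 1, Summable fun n => ‖u n‖ * r ^ n) :
    ∀ r ∈ Ioo (0 : ℝ) 1, Summable fun n : ℕ => ‖((n : ℂ) + 1) * u (n + 1)‖ * r ^ n := by
  intro r hr
  obtain ⟨R, hrR, hR⟩ := exists_between hr.2
  have hO := (isLittleO_pow_const_mul_const_pow_const_pow_of_norm_lt 1
    (show ‖r‖ < R by rwa [Real.norm_of_nonneg hr.1.le])).isBigO
  have h := summable_of_isBigO_nat (hu R ⟨hr.1.trans hrR, hR⟩)
    ((Asymptotics.isBigO_refl (fun n => ‖u n‖) Filter.atTop).mul hO)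
  refine (((summable_nat_add_iff 1).2 h).mul_left r⁻¹).congr fun n => ?_
  have hn : ‖(n : ℂ) + 1‖ = (n : ℝ) + 1 := by exact_mod_cast Complex.norm_natCast (n + 1)
  have hr0 := hr.1.ne'
  rw [norm_mul, hn, pow_succ r n]
  push_cast
  field_simp

lemma summable_mul_pow {u : ℕ → ℂ}
    (hu : ∀ r ∈ Ioo (0 : ℝ) 1, Summable fun n => ‖u n‖ * r ^ n) {z : ℂ} (hz : ‖z‖ < 1) :
    Summable fun n => u n * z ^ n := by
  obtain ⟨r, hzr, hr⟩ := exists_between hz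
  refine Summable.of_norm_bounded (hu r ⟨(norm_nonneg z).trans_lt hzr, hr⟩) fun n => ?_
  rw [norm_mul, norm_pow]
  gcongr

lemma hasDerivAt_tsum_mul_pow {u : ℕ → ℂ}
    (hu : ∀ r ∈ Ioo (0 : ℝ) 1, Summable fun n => ‖u n‖ * r ^ n) {z : ℂ} (hz : ‖z‖ < 1) :
    HasDerivAt (fun w => ∑' n, u n * w ^ n) (∑' n : ℕ, ((n : ℂ) + 1) * u (n + 1) * z ^ n) z := by
  obtain ⟨r, hzr, hr⟩ := exists_between hz
  have hs := hu r ⟨(norm_nonneg z).trans_lt hzr, hr⟩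
  have hd : ∀ n, DifferentiableOn ℂ (fun w => u n * w ^ n) (Metric.ball 0 r) :=
    fun n => by fun_prop
  have hb : ∀ n, ∀ w ∈ Metric.ball (0 : ℂ) r, ‖u n * w ^ n‖ ≤ ‖u n‖ * r ^ n := fun n w hw => by
    rw [norm_mul, norm_pow]
    gcongr
    exact (mem_ball_zero_iff.1 hw).le
  have hzb : z ∈ Metric.ball (0 : ℂ) r := mem_ball_zero_iff.2 hzr
  have h := hasSum_deriv_of_summable_norm hs hd Metric.isOpen_ball hb hzb
  have hD := ((differentiableOn_tsum_of_summable_norm hs hd Metric.isOpen_ball hb).differentiableAt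
    (Metric.isOpen_ball.mem_nhds hzb)).hasDerivAt
  rw [← h.tsum_eq, h.summable.tsum_eq_zero_add] at hD
  have hderiv : ∀ n : ℕ, deriv (fun w => u n * w ^ n) z = u n * (n * z ^ (n - 1)) := fun n =>
    ((hasDerivAt_pow n z).const_mul (u n)).deriv
  simp only [hderiv, Nat.cast_zero, zero_mul, mul_zero, zero_add, Nat.add_sub_cancel] at hD
  refine hD.congr_deriv (tsum_congr fun n => ?_)
  push_cast
  ring

lemma HasSum.mul_pow_of_succ {g : ℕ → ℂ} {z S : ℂ} (h0 : g 0 = 0)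
    (h : HasSum (fun n => g (n + 1) * z ^ n) S) : HasSum (fun n => g n * z ^ n) (z * S) := by
  rw [← hasSum_nat_add_iff' 1]
  simpa [h0, pow_succ, mul_assoc, mul_comm, mul_left_comm] using h.mul_left z

/-- The Gauss hypergeometric series satisfies the hypergeometric differential equation. -/
lemma hyp2F1_ode (a b : ℂ) {c : ℂ} (hc : ∀ n : ℕ, c ≠ -(n : ℂ)) :
    ∃ F₁ F₂ : ℂ → ℂ, ∀ z : ℂ, ‖z‖ < 1 →
      HasDerivAt (hyp2F1 a b c) (F₁ z) z ∧ HasDerivAt F₁ (F₂ z) z ∧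
      z * (1 - z) * F₂ z + (c - (a + b + 1) * z) * F₁ z - a * b * hyp2F1 a b c z = 0 := by
  set u := hyp2F1Coeff a b c with hu_def
  have hu : ∀ r ∈ Ioo (0 : ℝ) 1, Summable fun n => ‖u n‖ * r ^ n :=
    fun r hr => summable_norm_hyp2F1Coeff a b c hr
  set v : ℕ → ℂ := fun n => ((n : ℂ) + 1) * u (n + 1) with hv_def
  have hv : ∀ r ∈ Ioo (0 : ℝ) 1, Summable fun n => ‖v n‖ * r ^ n := summable_norm_succ_mul hu
  have hw := summable_norm_succ_mul hv
  refine ⟨fun z => ∑' n, v n * z ^ n, fun z => ∑' n : ℕ, ((n : ℂ) + 1) * v (n + 1) * z ^ n,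
    fun z hz => ⟨hasDerivAt_tsum_mul_pow hu hz, hasDerivAt_tsum_mul_pow hv hz, ?_⟩⟩
  have S₀ : HasSum (fun n => u n * z ^ n) (hyp2F1 a b c z) := (summable_mul_pow hu hz).hasSum
  have S₁ := (summable_mul_pow hv hz).hasSum
  have S₂ := (summable_mul_pow hw hz).hasSum
  set F₀ := hyp2F1 a b c z
  set F₁ := ∑' n, v n * z ^ n
  set F₂ := ∑' n : ℕ, ((n : ℂ) + 1) * v (n + 1) * z ^ n
  have T₁ : HasSum (fun n : ℕ => (n : ℂ) * u n * z ^ n) (z * F₁) :=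
    HasSum.mul_pow_of_succ (g := fun n => (n : ℂ) * u n) (by simp) (by simpa using S₁)
  have T₂ : HasSum (fun n : ℕ => (n : ℂ) * v n * z ^ n) (z * F₂) :=
    HasSum.mul_pow_of_succ (g := fun n => (n : ℂ) * v n) (by simp) (by simpa using S₂)
  have T₃ : HasSum (fun n : ℕ => (n : ℂ) * ((n : ℂ) - 1) * u n * z ^ n) (z * (z * F₂)) := by
    refine HasSum.mul_pow_of_succ (g := fun n => (n : ℂ) * ((n : ℂ) - 1) * u n) (by simp) ?_
    refine T₂.congr_fun ?_
    intro n
    simp only [hv_def]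
    push_cast
    ring
  have H := ((((T₂.sub T₃).add (S₁.mul_left c)).sub (T₁.mul_left (a + b + 1))).sub
    (S₀.mul_left (a * b)))
  have h0 : z * F₂ - z * (z * F₂) + c * F₁ - (a + b + 1) * (z * F₁) - a * b * F₀ = 0 := by
    refine H.unique ?_
    refine hasSum_zero.congr_fun fun n => ?_
    simp only [hv_def, hu_def]
    linear_combination z ^ n * hyp2F1Coeff_succ a b hc n
  linear_combination h0

lemma hasDerivAt_ofReal_cpow {x : ℝ} (hx : 0 < x) (s : ℂ) :
    HasDerivAt (fun y : ℝ => (y : ℂ) ^ s) (s * (x : ℂ) ^ s / x) x := by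
  have hx0 : (x : ℂ) ≠ 0 := by exact_mod_cast hx.ne'
  have h : HasDerivAt (fun z : ℂ => z ^ s) (s * (x : ℂ) ^ (s - 1)) (x : ℂ) := by
    simpa using (hasDerivAt_id (x : ℂ)).cpow_const (c := s) (Or.inl (by simpa using hx))
  convert h.comp_ofReal using 1
  rw [Complex.cpow_sub _ _ hx0, Complex.cpow_one, mul_div_assoc]

lemma hasDerivAt_one_sub_ofReal_cpow {x : ℝ} (hx : x < 1) (s : ℂ) :
    HasDerivAt (fun y : ℝ => (1 - (y : ℂ)) ^ s) (-(s * (1 - (x : ℂ)) ^ s / (1 - x))) x := by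
  have h := (hasDerivAt_ofReal_cpow (sub_pos.2 hx) s).scomp x ((hasDerivAt_id x).const_sub 1)
  simpa [Function.comp_def] using h

/-- Expanded form of the crosscap Casimir operator. -/
lemma Dproj_eq {h Δm : ℝ} {f : ℝ → ℂ} {η : ℝ} {f₂ : ℂ} (hη : η ∈ Ioo (0 : ℝ) 1)
    (hf : HasDerivAt (deriv f) f₂ η) :
    Dproj h Δm f η = 4 * (η : ℂ) ^ 2 * (1 - η) * f₂ + 4 * η * (1 - h - η) * deriv f η +
      4 * (Δm : ℂ) ^ 2 * η * f η := by
  have h0 : (η : ℂ) ≠ 0 := by exact_mod_cast hη.1.ne'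
  have h1 : (1 - η : ℂ) ≠ 0 := by exact_mod_cast (sub_pos.2 hη.2).ne'
  have hd := ((hasDerivAt_one_sub_ofReal_cpow hη.2 ((h : ℝ) : ℂ)).mul
    (hasDerivAt_ofReal_cpow hη.1 ((1 - h : ℝ) : ℂ))).mul hf
  have hd' : deriv (fun y : ℝ =>
      (1 - (y : ℂ)) ^ ((h : ℝ) : ℂ) * (y : ℂ) ^ ((1 - h : ℝ) : ℂ) * deriv f y) η = _ := hd.deriv
  rw [Dproj, hd']
  push_cast
  have hX : (η : ℂ) ^ (h : ℂ) ≠ 0 := by simp [Complex.cpow_eq_zero_iff, h0]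
  have hP : (1 - η : ℂ) ^ (h : ℂ) ≠ 0 := by simp [Complex.cpow_eq_zero_iff, h1]
  simp only [Pi.mul_apply]
  rw [Complex.cpow_add _ _ h0, Complex.cpow_sub _ _ h0, Complex.cpow_sub _ _ h1, Complex.cpow_one,
    Complex.cpow_one]
  field_simp
  ring

theorem stmt9 (d Δ₁ Δ₂ h Δm : ℝ) (hh : h = d / 2) (hm : Δm = (Δ₁ - Δ₂) / 2)
    (Δ : ℂ) (hΔ : ∀ n : ℕ, Δ + 1 - (h : ℂ) ≠ -(n : ℂ)) :
    ∀ η ∈ Ioo (0 : ℝ) 1,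
      DifferentiableAt ℝ (Gproj h Δm Δ) η ∧
      DifferentiableAt ℝ (deriv (Gproj h Δm Δ)) η ∧
      Dproj h Δm (Gproj h Δm Δ) η = Δ * (Δ - (d : ℂ)) * Gproj h Δm Δ η := by
  subst hh
  obtain ⟨F₁, F₂, hF⟩ := hyp2F1_ode (Δ / 2 + (Δm : ℂ)) (Δ / 2 - (Δm : ℂ)) hΔ
  set F := hyp2F1 (Δ / 2 + (Δm : ℂ)) (Δ / 2 - (Δm : ℂ)) (Δ + 1 - ((d / 2 : ℝ) : ℂ)) with hF_def
  have hnorm : ∀ y ∈ Ioo (0 : ℝ) 1, ‖(y : ℂ)‖ < 1 := fun y hy => by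
    rw [Complex.norm_real, Real.norm_of_nonneg hy.1.le]
    exact hy.2
  have hG : ∀ y ∈ Ioo (0 : ℝ) 1, HasDerivAt (Gproj (d / 2) Δm Δ)
      (Δ / 2 * (y : ℂ) ^ (Δ / 2) / y * F y + (y : ℂ) ^ (Δ / 2) * F₁ y) y := fun y hy =>
    (hasDerivAt_ofReal_cpow hy.1 (Δ / 2)).mul (hF y (hnorm y hy)).1.comp_ofReal
  intro η hη
  have h0 : (η : ℂ) ≠ 0 := by exact_mod_cast hη.1.ne'
  have hev : deriv (Gproj (d / 2) Δm Δ) =ᶠ[nhds η] fun y : ℝ =>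
      Δ / 2 * (y : ℂ) ^ (Δ / 2) / y * F y + (y : ℂ) ^ (Δ / 2) * F₁ y := by
    filter_upwards [Ioo_mem_nhds hη.1 hη.2] with y hy using (hG y hy).deriv
  obtain ⟨hF₁, hF₂, hode⟩ := hF η (hnorm η hη)
  have hp := hasDerivAt_ofReal_cpow hη.1 (Δ / 2)
  have hG₂ := ((((hp.const_mul (Δ / 2)).fun_div Complex.ofRealCLM.hasDerivAt h0).fun_mul
    hF₁.comp_ofReal).fun_add (hp.fun_mul hF₂.comp_ofReal)).congr_of_eventuallyEq hev
  refine ⟨(hG η hη).differentiableAt, hG₂.differentiableAt, ?_⟩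
  rw [Dproj_eq hη hG₂, (hG η hη).deriv, Gproj, ← hF_def]
  push_cast at hode ⊢
  simp only [Complex.ofRealCLM_apply, Complex.ofReal_one]
  field_simp
  linear_combination (16 * (η : ℂ) ^ (Δ / 2) * η) * hode
end
end
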